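/- Let (X,d) be a complete separable metric space and m a nonnegative Borel measure on X, finite on bounded sets, with 0 < m(X) < ∞. Then for every q ∈ (1,∞) one has λ_{1,q}(X) ≥ (h(X)/q)^q, i.e. h(X) ≤ q·(λ_{1,q}(X))^{1/q}. In particular, taking q = 2 yields Cheeger's inequality λ_{1,2}(X) ≥ h(X)²/4. -/

import Mathlib

open MeasureTheory Filter Topology ENNReal

/-- The slope (pointwise Lipschitz constant) of `f` at `x`, with the convention that it is `0`
at isolated points. -/
noncomputable def lipSlope {X : Type*} [MetricSpace X] (f : X → ℝ) (x : X) : ℝ :=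
  Filter.limsup (fun y => |f y - f x| / dist y x) (𝓝[≠] x)

/-- Lipschitz functions with bounded support. -/
def LipBS {X : Type*} [MetricSpace X] (f : X → ℝ) : Prop :=
  (∃ K : NNReal, LipschitzWith K f) ∧ Bornology.IsBounded (Function.support f)

/-- Functions which are Lipschitz on bounded sets. -/
def LipLoc {X : Type*} [MetricSpace X] (f : X → ℝ) : Prop :=
  ∀ s : Set X, Bornology.IsBounded s → ∃ K : NNReal, LipschitzOnWith K f s

/-- The perimeter of a Borel set `A`:
`Per(A) = inf { liminf_n ∫ lip(f_n) dm : f_n ∈ Lip_loc(X), f_n → χ_A in L¹(X,m) }`. -/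
noncomputable def perimeter {X : Type*} [MetricSpace X] [MeasurableSpace X]
    (m : Measure X) (A : Set X) : ℝ≥0∞ :=
  sInf { p : ℝ≥0∞ | ∃ f : ℕ → X → ℝ, (∀ n, LipLoc (f n)) ∧
    Tendsto (fun n => ∫⁻ x, ENNReal.ofReal |f n x - A.indicator (fun _ => (1:ℝ)) x| ∂m)
      atTop (𝓝 0) ∧
    p = Filter.liminf (fun n => ∫⁻ x, ENNReal.ofReal (lipSlope (f n) x) ∂m) atTop }

/-- The Cheeger constant (finite measure case):
`h(X) = inf { Per(A)/m(A) : A Borel, 0 < m(A) ≤ m(X)/2 }`. -/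
noncomputable def cheegerFin {X : Type*} [MetricSpace X] [MeasurableSpace X]
    (m : Measure X) : ℝ≥0∞ :=
  sInf { h : ℝ≥0∞ | ∃ A : Set X, MeasurableSet A ∧ 0 < m A ∧ m A ≤ m Set.univ / 2 ∧
    h = perimeter m A / m A }

/-- The first nontrivial `q`-eigenvalue `λ_{1,q}` (finite measure case). -/
noncomputable def lambdaOneP {X : Type*} [MetricSpace X] [MeasurableSpace X]
    (m : Measure X) (q : ℝ) : ℝ≥0∞ :=
  sInf { l : ℝ≥0∞ | ∃ f : X → ℝ, LipBS f ∧ ¬ (f =ᵐ[m] 0) ∧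
    (∫ x, |f x| ^ (q - 2) * f x ∂m) = 0 ∧
    l = (∫⁻ x, ENNReal.ofReal ((lipSlope f x) ^ q) ∂m) /
        (∫⁻ x, ENNReal.ofReal (|f x| ^ q) ∂m) }


/-- Extended-real valued slope. -/
noncomputable def eSlope {X : Type*} [MetricSpace X] (f : X → ℝ) (x : X) : ℝ≥0∞ :=
  Filter.limsup (fun y => ENNReal.ofReal (|f y - f x| / dist y x)) (𝓝[≠] x)

lemma quot_le {X : Type*} [MetricSpace X] {f : X → ℝ} {K : NNReal} (hf : LipschitzWith K f)
    (x y : X) : |f y - f x| / dist y x ≤ K := by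
  apply div_le_of_le_mul₀ dist_nonneg K.2
  have := hf.dist_le_mul y x
  rwa [Real.dist_eq] at this

lemma lipSlope_bounds {X : Type*} [MetricSpace X] {f : X → ℝ} {K : NNReal}
    (hf : LipschitzWith K f) (x : X) :
    ENNReal.ofReal (lipSlope f x) = eSlope f x ∧ 0 ≤ lipSlope f x := by
  unfold lipSlope eSlope
  rcases eq_or_neBot (𝓝[≠] x) with h | h
  · rw [h]
    simp [Filter.limsup, Filter.limsSup]
  · have hb : IsBoundedUnder (· ≤ ·) (𝓝[≠] x) (fun y => |f y - f x| / dist y x) :=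
      isBoundedUnder_of ⟨K, quot_le hf x⟩
    have hc : IsBoundedUnder (· ≥ ·) (𝓝[≠] x) (fun y => |f y - f x| / dist y x) :=
      isBoundedUnder_of ⟨0, fun y => by positivity⟩
    constructor
    · exact Monotone.map_limsup_of_continuousAt (f := ENNReal.ofReal) ENNReal.ofReal_mono _
        ENNReal.continuous_ofReal.continuousAt hb hc.isCoboundedUnder_flip
    · apply le_limsup_of_frequently_le _ hb
      exact Frequently.of_forall fun y => by positivity

lemma eSlope_le_of_eventually {X : Type*} [MetricSpace X] {F f : X → ℝ} {x : X} {C : ℝ}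
    (hC : 0 ≤ C) (h : ∀ᶠ y in 𝓝 x, |F y - F x| ≤ C * |f y - f x|) :
    eSlope F x ≤ ENNReal.ofReal C * eSlope f x := by
  unfold eSlope
  rw [← ENNReal.limsup_const_mul_of_ne_top ENNReal.ofReal_ne_top]
  apply limsup_le_limsup
  · filter_upwards [nhdsWithin_le_nhds h] with y hy
    rw [← ENNReal.ofReal_mul hC, ← mul_div_assoc]
    exact ENNReal.ofReal_le_ofReal (div_le_div_of_nonneg_right hy dist_nonneg)
  · isBoundedDefault
  · isBoundedDefault

lemma measurable_eSlope {X : Type*} [MetricSpace X] [MeasurableSpace X] [BorelSpace X]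
    {f : X → ℝ} (hf : Continuous f) : Measurable (eSlope f) := by
  have key : eSlope f = fun x => ⨅ n : ℕ, ⨆ y, ⨆ _ : y ∈ Metric.ball x (1 / ((n:ℝ) + 1)) ∩ {x}ᶜ,
      ENNReal.ofReal (|f y - f x| / dist y x) := by
    funext x
    unfold eSlope
    have hb : (𝓝[≠] x).HasBasis (fun _ : ℕ => True)
        (fun n => Metric.ball x (1 / ((n:ℝ) + 1)) ∩ {x}ᶜ) :=
      nhdsWithin_hasBasis Metric.nhds_basis_ball_inv_nat_succ _
    rw [hb.limsup_eq_iInf_iSup]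
    simp
  rw [key]
  refine Measurable.iInf fun n => ?_
  apply LowerSemicontinuous.measurable
  intro x a ha
  simp only [lt_iSup_iff] at ha ⊢
  obtain ⟨y, hy, hay⟩ := ha
  have hyx : y ≠ x := hy.2
  have hcont : ContinuousAt (fun x' => ENNReal.ofReal (|f y - f x'| / dist y x')) x := by
    apply ENNReal.continuous_ofReal.continuousAt.comp
    apply ContinuousAt.div
    · fun_prop
    · fun_prop
    · exact dist_ne_zero.2 hyx
  have h1 := hcont.eventually (lt_mem_nhds hay)
  have h2 : ∀ᶠ x' in 𝓝 x, dist y x' < 1 / ((n:ℝ) + 1) := by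
    have hc : ContinuousAt (fun x' => dist y x') x := by fun_prop
    exact hc.eventually (gt_mem_nhds hy.1)
  have h3 : ∀ᶠ x' in 𝓝 x, x' ≠ y := isOpen_ne.mem_nhds hyx.symm
  filter_upwards [h1, h2, h3] with x' e1 e2 e3
  exact ⟨y, ⟨e2, fun h => e3 h.symm⟩, e1⟩

/-- cutoff function -/
noncomputable def cut (k t s : ℝ) : ℝ := max 0 (min 1 (k * (s - t)))

lemma cut_lip {k : ℝ} (hk : 0 ≤ k) (t s s' : ℝ) : |cut k t s - cut k t s'| ≤ k * |s - s'| := by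
  unfold cut
  have h1 := abs_max_sub_max_le_abs (min 1 (k * (s - t))) (min 1 (k * (s' - t))) 0
  have h2 := abs_min_sub_min_le_max 1 (k * (s - t)) 1 (k * (s' - t))
  rw [max_comm 0, max_comm 0]
  refine h1.trans (h2.trans ?_)
  rw [sub_self, abs_zero, max_eq_right (abs_nonneg _)]
  rw [← mul_sub, abs_mul, abs_of_nonneg hk]
  simp

lemma perimeter_le {X : Type*} [MetricSpace X] [MeasurableSpace X] [BorelSpace X]
    (m : Measure X) [IsFiniteMeasure m] {u : X → ℝ} {K : NNReal} (hu : LipschitzWith K u) (t : ℝ) :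
    perimeter m {x | t < u x} ≤ Filter.liminf (fun n : ℕ =>
      ∫⁻ x, ENNReal.ofReal ((n:ℝ)+1) * (eSlope u x *
        (Set.Icc (u x - 1/((n:ℝ)+1)) (u x)).indicator 1 t) ∂m) atTop := by
  have hmono : ∀ n : ℕ, LipschitzWith (((n:NNReal)+1) * K) (fun x => cut ((n:ℝ)+1) t (u x)) := by
    intro n
    apply LipschitzWith.of_dist_le_mul
    intro x y
    rw [Real.dist_eq]
    refine (cut_lip (by positivity) _ _ _).trans ?_
    have := hu.dist_le_mul x y
    rw [Real.dist_eq] at this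
    push_cast
    rw [mul_assoc]
    gcongr
  have hcutmeas : ∀ n : ℕ, Measurable (fun x => cut ((n:ℝ)+1) t (u x)) :=
    fun n => (hmono n).continuous.measurable
  have hA : MeasurableSet {x | t < u x} := measurableSet_lt measurable_const hu.continuous.measurable
  unfold perimeter
  refine le_trans (sInf_le (Set.mem_setOf.2
    ⟨fun (n : ℕ) x => cut ((n:ℝ)+1) t (u x), ?_, ?_, rfl⟩)) ?_
  · intro n s _
    exact ⟨_, (hmono n).lipschitzOnWith⟩
  · have h0 : (0:ℝ≥0∞) = ∫⁻ x : X, 0 ∂m := by simp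
    rw [h0]
    apply tendsto_lintegral_of_dominated_convergence (fun _ => (1:ℝ≥0∞))
    · intro n
      exact (((hcutmeas n).sub (measurable_const.indicator hA)).abs).ennreal_ofReal
    · intro n
      refine Eventually.of_forall fun x => ?_
      simp only
      rw [← ENNReal.ofReal_one]
      apply ENNReal.ofReal_le_ofReal
      have a1 : 0 ≤ cut ((n:ℝ)+1) t (u x) := le_max_left _ _
      have a2 : cut ((n:ℝ)+1) t (u x) ≤ 1 := max_le zero_le_one (min_le_left _ _)
      by_cases hx : t < u x
      · rw [Set.indicator_of_mem (show x ∈ {x | t < u x} from hx), abs_le]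
        constructor <;> linarith
      · rw [Set.indicator_of_notMem (show x ∉ {x | t < u x} from hx), abs_le]
        constructor <;> linarith
    · simp
    · refine Eventually.of_forall fun x => ?_
      by_cases hx : t < u x
      · apply tendsto_const_nhds.congr'
        obtain ⟨N, hN⟩ := exists_nat_gt (1 / (u x - t))
        filter_upwards [eventually_ge_atTop N] with n hn
        have hpos : 0 < u x - t := by linarith
        rw [div_lt_iff₀ hpos] at hN
        have hn' : (N:ℝ) ≤ n := by exact_mod_cast hn
        have : 1 ≤ ((n:ℝ)+1) * (u x - t) := by nlinarith
        rw [Set.indicator_of_mem (show x ∈ {x | t < u x} from hx)]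
        simp [cut, min_eq_left this]
      · apply tendsto_const_nhds.congr
        intro n
        rw [Set.indicator_of_notMem (show x ∉ {x | t < u x} from hx)]
        have : ((n:ℝ)+1) * (u x - t) ≤ 0 :=
          mul_nonpos_of_nonneg_of_nonpos (by positivity) (by linarith)
        have h2 : min 1 (((n:ℝ)+1) * (u x - t)) ≤ 0 := (min_le_right _ _).trans this
        simp only [cut, max_eq_left h2]
        simp
  · apply liminf_le_liminf
    · refine Eventually.of_forall fun n => ?_
      apply lintegral_mono
      intro x
      simp only
      rw [(lipSlope_bounds (hmono n) x).1]
      have hn : (0:ℝ) < (n:ℝ)+1 := by positivity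
      by_cases hx : t ∈ Set.Icc (u x - 1/((n:ℝ)+1)) (u x)
      · rw [Set.indicator_of_mem hx]
        simp only [Pi.one_apply, mul_one]
        exact eSlope_le_of_eventually (by positivity)
          (Eventually.of_forall fun y => cut_lip (by positivity) _ _ _)
      · rw [Set.indicator_of_notMem hx]
        have : eSlope (fun x => cut ((n:ℝ)+1) t (u x)) x ≤ ENNReal.ofReal 0 * eSlope u x := by
          apply eSlope_le_of_eventually le_rfl
          rw [Set.mem_Icc, not_and_or, not_le, not_le] at hx
          have hcu : ContinuousAt u x := hu.continuous.continuousAt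
          rcases hx with hx | hx
          · have h1 : ∀ z, t < z - 1/((n:ℝ)+1) → cut ((n:ℝ)+1) t z = 1 := by
              intro z hz
              have h3 : 1/((n:ℝ)+1) < z - t := by linarith
              rw [div_lt_iff₀ hn] at h3
              have : 1 ≤ ((n:ℝ)+1) * (z - t) := by nlinarith
              simp [cut, min_eq_left this]
            have hc : ContinuousAt (fun y => u y - 1/((n:ℝ)+1)) x := by fun_prop
            filter_upwards [hc.eventually (lt_mem_nhds hx)] with y hy
            rw [h1 _ hx, h1 _ hy]; simp
          · have h1 : ∀ z, z < t → cut ((n:ℝ)+1) t z = 0 := by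
              intro z hz
              have : ((n:ℝ)+1) * (z - t) ≤ 0 :=
                mul_nonpos_of_nonneg_of_nonpos (by positivity) (by linarith)
              have h2 : min 1 (((n:ℝ)+1) * (z - t)) ≤ 0 := (min_le_right _ _).trans this
              simp only [cut, max_eq_left h2]
            filter_upwards [hcu.eventually (gt_mem_nhds hx)] with y hy
            rw [h1 _ hx, h1 _ hy]; simp
        simpa using this
    · isBoundedDefault
    · isBoundedDefault

lemma coarea {X : Type*} [MetricSpace X] [MeasurableSpace X] [BorelSpace X]
    (m : Measure X) [IsFiniteMeasure m] {u : X → ℝ} {K : NNReal} (hu : LipschitzWith K u)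
    (hu0 : ∀ x, 0 ≤ u x) (h : ℝ≥0∞)
    (hP : ∀ t, 0 < t → h * m {x | t < u x} ≤ perimeter m {x | t < u x}) :
    h * ∫⁻ x, ENNReal.ofReal (u x) ∂m ≤ ∫⁻ x, eSlope u x ∂m := by
  have hum : Measurable u := hu.continuous.measurable
  have hsm := measurable_eSlope hu.continuous
  have hjm : ∀ n : ℕ, Measurable (fun p : ℝ × X => ENNReal.ofReal ((n:ℝ)+1) * (eSlope u p.2 *
        (Set.Icc (u p.2 - 1/((n:ℝ)+1)) (u p.2)).indicator 1 p.1)) := by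
    intro n
    refine measurable_const.mul ((hsm.comp measurable_snd).mul ?_)
    have : (fun p : ℝ × X => (Set.Icc (u p.2 - 1/((n:ℝ)+1)) (u p.2)).indicator
        (1 : ℝ → ℝ≥0∞) p.1) =
        {p : ℝ × X | u p.2 - 1/((n:ℝ)+1) ≤ p.1 ∧ p.1 ≤ u p.2}.indicator (fun _ => 1) := by
      funext p
      simp [Set.indicator, Set.mem_Icc]
    rw [this]
    apply measurable_const.indicator
    apply MeasurableSet.inter
    · exact measurableSet_le (by fun_prop) measurable_fst
    · exact measurableSet_le measurable_fst (by fun_prop)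
  rw [lintegral_eq_lintegral_meas_lt m (Eventually.of_forall hu0) hum.aemeasurable]
  have hanti : Measurable (fun t => m {x | t < u x}) := by
    apply Antitone.measurable
    intro s t hst
    exact measure_mono fun x hx => lt_of_le_of_lt hst hx
  rw [← lintegral_const_mul _ hanti]
  calc ∫⁻ t in Set.Ioi 0, h * m {x | t < u x}
      ≤ ∫⁻ t in Set.Ioi (0:ℝ), Filter.liminf (fun n : ℕ =>
        ∫⁻ x, ENNReal.ofReal ((n:ℝ)+1) * (eSlope u x *
        (Set.Icc (u x - 1/((n:ℝ)+1)) (u x)).indicator 1 t) ∂m) atTop := by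
        apply setLIntegral_mono' measurableSet_Ioi
        intro t ht
        exact (hP t ht).trans (perimeter_le m hu t)
    _ ≤ ∫⁻ t, Filter.liminf (fun n : ℕ =>
        ∫⁻ x, ENNReal.ofReal ((n:ℝ)+1) * (eSlope u x *
        (Set.Icc (u x - 1/((n:ℝ)+1)) (u x)).indicator 1 t) ∂m) atTop := setLIntegral_le_lintegral _ _
    _ ≤ Filter.liminf (fun n : ℕ => ∫⁻ t,
        ∫⁻ x, ENNReal.ofReal ((n:ℝ)+1) * (eSlope u x *
        (Set.Icc (u x - 1/((n:ℝ)+1)) (u x)).indicator 1 t) ∂m) atTop :=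
        lintegral_liminf_le fun n => (hjm n).lintegral_prod_right'
    _ = Filter.liminf (fun n : ℕ => ∫⁻ x, eSlope u x ∂m) atTop := by
        congr 1
        funext n
        rw [lintegral_lintegral_swap (hjm n).aemeasurable]
        apply lintegral_congr
        intro x
        have hi : Measurable ((Set.Icc (u x - 1/((n:ℝ)+1)) (u x)).indicator (1 : ℝ → ℝ≥0∞)) :=
          measurable_one.indicator measurableSet_Icc
        rw [lintegral_const_mul _ (hi.const_mul _), lintegral_const_mul _ hi,
          lintegral_indicator_one measurableSet_Icc, Real.volume_Icc, mul_left_comm,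
          ← ENNReal.ofReal_mul (by positivity)]
        have hn : ((n:ℝ)+1) ≠ 0 := by positivity
        have : ((n:ℝ)+1) * (u x - (u x - 1/((n:ℝ)+1))) = 1 := by field_simp; ring
        rw [this]; simp
    _ = ∫⁻ x, eSlope u x ∂m := by simp

lemma bern {q : ℝ} (hq : 1 < q) (r : ℝ) : 1 + q * (r - 1) ≤ |r| ^ q := by
  rcases le_or_gt 0 r with h | h
  · have := one_add_mul_self_le_rpow_one_add (s := r - 1) (by linarith) hq.le
    rw [abs_of_nonneg h]
    simpa using this
  · have : 0 ≤ |r| ^ q := by positivity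
    nlinarith

lemma tangent {q : ℝ} (hq : 1 < q) (a c : ℝ) :
    |a| ^ q - q * c * (|a| ^ (q - 2) * a) ≤ |a - c| ^ q := by
  rcases eq_or_ne a 0 with h | h
  · subst h
    have : 0 ≤ |0 - c| ^ q := by positivity
    rw [abs_zero, Real.zero_rpow (by linarith)]
    simpa using this
  · have h1 := bern hq ((a - c) / a)
    have hp : 0 < |a| := abs_pos.2 h
    rw [abs_div, Real.div_rpow (abs_nonneg _) (abs_nonneg _), le_div_iff₀ (by positivity)] at h1
    refine le_trans (le_of_eq ?_) h1
    have h2 : |a| ^ q = |a| ^ (q - 2) * (a * a) := by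
      have : |a| ^ q = |a| ^ (q - 2 + 2) := by congr 1; ring
      rw [this, Real.rpow_add hp]
      congr 1
      rw [Real.rpow_two, sq_abs]; ring
    rw [h2]
    field_simp
    ring

lemma rpow_sub_bound {q : ℝ} (hq : 1 < q) {a b : ℝ} (ha : 0 ≤ a) (hb : 0 ≤ b) :
    |a ^ q - b ^ q| ≤ q * max a b ^ (q - 1) * |a - b| := by
  wlog hab : b ≤ a generalizing a b
  · have := this hb ha (not_le.1 hab).le
    rwa [abs_sub_comm, max_comm, abs_sub_comm a b]
  rw [max_eq_left hab, abs_of_nonneg (sub_nonneg.2 hab),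
    abs_of_nonneg (sub_nonneg.2 (Real.rpow_le_rpow hb hab (by linarith)))]
  have h := tangent hq a (a - b)
  rw [_root_.sub_sub_cancel, abs_of_nonneg ha, abs_of_nonneg hb] at h
  rcases eq_or_lt_of_le ha with h0 | h0
  · have : b = 0 := by linarith
    subst this; rw [← h0]; simp
  · have h2 : a ^ (q - 2) * a = a ^ (q - 1) := by
      have : a ^ (q - 1) = a ^ (q - 2 + 1) := by congr 1; ring
      rw [this, Real.rpow_add h0, Real.rpow_one]
    rw [h2] at h
    nlinarith

lemma main_half {X : Type*} [MetricSpace X] [MeasurableSpace X] [BorelSpace X]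
    (m : Measure X) [IsFiniteMeasure m] {q : ℝ} (hq : 1 < q) {g : X → ℝ} {K : NNReal}
    (hg : LipschitzWith K g) {M : ℝ} (hM : ∀ x, |g x| ≤ M)
    (hhalf : m {x | 0 < g x} ≤ m Set.univ / 2) :
    cheegerFin m * ∫⁻ x, ENNReal.ofReal (max (g x) 0 ^ q) ∂m ≤
      ∫⁻ x, ENNReal.ofReal (q * max (g x) 0 ^ (q - 1)) * eSlope g x ∂m := by
  have hpt : ∀ x y, |max (g y) 0 ^ q - max (g x) 0 ^ q| ≤
      q * max (max (g y) 0) (max (g x) 0) ^ (q - 1) * |g y - g x| := by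
    intro x y
    refine (rpow_sub_bound hq (le_max_right _ _) (le_max_right _ _)).trans ?_
    have : |max (g y) 0 - max (g x) 0| ≤ |g y - g x| := abs_max_sub_max_le_abs _ _ _
    gcongr
  have hM' : ∀ x, max (g x) 0 ≤ max M 0 := fun x =>
    max_le_max_right _ ((le_abs_self _).trans (hM x))
  have hC : 0 ≤ q * max M 0 ^ (q - 1) := by positivity
  have hu : LipschitzWith (Real.toNNReal (q * max M 0 ^ (q - 1)) * K)
      (fun x => max (g x) 0 ^ q) := by
    apply LipschitzWith.of_dist_le_mul
    intro x y
    rw [Real.dist_eq]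
    have hd := hg.dist_le_mul x y
    rw [Real.dist_eq] at hd
    rw [NNReal.coe_mul, Real.coe_toNNReal _ hC, mul_assoc]
    refine (hpt y x).trans ?_
    apply mul_le_mul _ hd (abs_nonneg _) hC
    apply mul_le_mul_of_nonneg_left _ (by linarith)
    apply Real.rpow_le_rpow (by positivity) (max_le (hM' x) (hM' y)) (by linarith)
  refine (coarea m hu (fun x => by positivity) _ ?_).trans ?_
  · intro t ht
    rcases eq_or_ne (m {x | t < max (g x) 0 ^ q}) 0 with h0 | h0
    · rw [h0]; simp
    · apply ENNReal.mul_le_of_le_div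
      apply sInf_le
      refine ⟨_, measurableSet_lt measurable_const hu.continuous.measurable,
        pos_iff_ne_zero.2 h0, ?_, rfl⟩
      refine le_trans (measure_mono ?_) hhalf
      intro x hx
      simp only [Set.mem_ofPred_eq] at hx ⊢
      by_contra hneg
      rw [max_eq_right (not_lt.1 hneg), Real.zero_rpow (by linarith)] at hx
      linarith
  · apply lintegral_mono
    intro x
    simp only
    have hcx : Continuous (fun y => q * max (max (g y) 0) (max (g x) 0) ^ (q - 1)) := by
      have := hg.continuous
      refine continuous_const.mul (Continuous.rpow_const (by fun_prop) fun y => Or.inr (by linarith))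
    have hne : eSlope g x ≠ ⊤ := by
      rw [← (lipSlope_bounds hg x).1]; exact ENNReal.ofReal_ne_top
    have hlim : Tendsto (fun c => ENNReal.ofReal c * eSlope g x)
        (𝓝[>] (q * max (g x) 0 ^ (q - 1)))
        (𝓝 (ENNReal.ofReal (q * max (g x) 0 ^ (q - 1)) * eSlope g x)) := by
      apply ENNReal.Tendsto.mul_const _ (Or.inr hne)
      exact (ENNReal.continuous_ofReal.tendsto _).mono_left nhdsWithin_le_nhds
    apply ge_of_tendsto hlim
    filter_upwards [self_mem_nhdsWithin] with c hc
    have hc' : q * max (g x) 0 ^ (q - 1) < c := hc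
    apply eSlope_le_of_eventually
    · exact le_trans (by positivity) hc'.le
    · have he : ∀ᶠ y in 𝓝 x, q * max (max (g y) 0) (max (g x) 0) ^ (q - 1) < c := by
        apply hcx.continuousAt.eventually (gt_mem_nhds _)
        simpa using hc'
      filter_upwards [he] with y hy
      exact (hpt x y).trans (mul_le_mul_of_nonneg_right hy.le (abs_nonneg _))

lemma exists_median {X : Type*} [MeasurableSpace X]
    (m : Measure X) [IsFiniteMeasure m] (hpos : 0 < m Set.univ) {f : X → ℝ} (hf : Measurable f)
    {M : ℝ} (hM : ∀ x, |f x| ≤ M) :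
    ∃ c, m {x | 0 < f x - c} ≤ m Set.univ / 2 ∧ m {x | 0 < c - f x} ≤ m Set.univ / 2 := by
  set S : Set ℝ := {t | m {x | t < f x} ≤ m Set.univ / 2} with hS
  have hMS : M ∈ S := by
    have : {x | M < f x} = ∅ := by
      ext x; simp; exact (le_abs_self _).trans (hM x)
    simp [hS, this]
  have hbd : BddBelow S := by
    refine ⟨-M, fun t ht => ?_⟩
    by_contra hlt
    rw [not_le] at hlt
    have : {x | t < f x} = Set.univ := by
      ext x; simp; linarith [(abs_le.1 (hM x)).1]
    rw [hS, Set.mem_ofPred_eq, this] at ht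
    exact absurd ht (not_le.2 (ENNReal.half_lt_self hpos.ne' (measure_ne_top _ _)))
  have hup : ∀ s t, s ∈ S → s ≤ t → t ∈ S := fun s t hs hst =>
    le_trans (measure_mono fun x hx => lt_of_le_of_lt hst hx) hs
  refine ⟨sInf S, ?_, ?_⟩
  · have : {x | 0 < f x - sInf S} = ⋃ n : ℕ, {x | sInf S + 1/((n:ℝ)+1) < f x} := by
      ext x
      simp only [Set.mem_ofPred_eq, Set.mem_iUnion]
      constructor
      · intro h
        obtain ⟨n, hn⟩ := exists_nat_one_div_lt h
        exact ⟨n, by linarith⟩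
      · rintro ⟨n, hn⟩
        have : 0 < 1/((n:ℝ)+1) := by positivity
        linarith
    rw [this]
    rw [Monotone.measure_iUnion]
    · apply iSup_le
      intro n
      have : sInf S < sInf S + 1/((n:ℝ)+1) := by
        have : 0 < 1/((n:ℝ)+1) := by positivity
        linarith
      obtain ⟨s, hs, hlt⟩ := exists_lt_of_csInf_lt ⟨M, hMS⟩ this
      exact hup s _ hs hlt.le
    · intro a b hab x hx
      simp only [Set.mem_ofPred_eq] at hx ⊢
      have := Nat.one_div_le_one_div (α := ℝ) hab
      linarith
  · have : {x | 0 < sInf S - f x} = ⋃ n : ℕ, {x | f x ≤ sInf S - 1/((n:ℝ)+1)} := by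
      ext x
      simp only [Set.mem_ofPred_eq, Set.mem_iUnion]
      constructor
      · intro h
        obtain ⟨n, hn⟩ := exists_nat_one_div_lt h
        exact ⟨n, by linarith⟩
      · rintro ⟨n, hn⟩
        have : 0 < 1/((n:ℝ)+1) := by positivity
        linarith
    rw [this]
    rw [Monotone.measure_iUnion]
    · apply iSup_le
      intro n
      set t := sInf S - 1/((n:ℝ)+1) with ht
      have hlt : t < sInf S := by
        have : 0 < 1/((n:ℝ)+1) := by positivity
        linarith
      have hn : t ∉ S := fun h => absurd (csInf_le hbd h) (not_le.2 hlt)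
      rw [hS, Set.mem_ofPred_eq, not_le] at hn
      have hcompl : {x | f x ≤ t} = {x | t < f x}ᶜ := by ext x; simp
      rw [hcompl, measure_compl (measurableSet_lt measurable_const hf) (measure_ne_top _ _)]
      rw [tsub_le_iff_right]
      calc m Set.univ = m Set.univ / 2 + m Set.univ / 2 := (ENNReal.add_halves _).symm
        _ ≤ _ := by gcongr
    · intro a b hab x hx
      simp only [Set.mem_ofPred_eq] at hx ⊢
      have := Nat.one_div_le_one_div (α := ℝ) hab
      linarith

lemma lintegral_shift {X : Type*} [MeasurableSpace X]
    (m : Measure X) [IsFiniteMeasure m] {q : ℝ} (hq : 1 < q) {f : X → ℝ} (hf : Measurable f)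
    {M : ℝ} (hM : ∀ x, |f x| ≤ M) (h0 : (∫ x, |f x| ^ (q - 2) * f x ∂m) = 0) (c : ℝ) :
    ∫⁻ x, ENNReal.ofReal (|f x| ^ q) ∂m ≤ ∫⁻ x, ENNReal.ofReal (|f x - c| ^ q) ∂m := by
  have hint : ∀ d, Integrable (fun x => |f x - d| ^ q) m := by
    intro d
    apply Integrable.of_bound (C := (M + |d|) ^ q)
    · exact ((hf.sub_const d).abs.pow_const q).aestronglyMeasurable
    · refine Eventually.of_forall fun x => ?_
      rw [Real.norm_of_nonneg (by positivity)]
      apply Real.rpow_le_rpow (abs_nonneg _) _ (by linarith)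
      exact (abs_sub _ _).trans (by linarith [hM x])
  have hint0 : Integrable (fun x => |f x| ^ q) m := by simpa using hint 0
  have hint2 : Integrable (fun x => |f x| ^ (q - 2) * f x) m := by
    apply Integrable.of_bound (C := M ^ (q - 1))
    · exact ((hf.abs.pow_const (q-2)).mul hf).aestronglyMeasurable
    · refine Eventually.of_forall fun x => ?_
      rw [norm_mul, Real.norm_of_nonneg (by positivity), Real.norm_eq_abs]
      have hM0 : 0 ≤ M := (abs_nonneg _).trans (hM x)
      rcases eq_or_ne (f x) 0 with h | h
      · rw [h]; simp; positivity
      · have hp : 0 < |f x| := abs_pos.2 h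
        have : |f x| ^ (q - 2) * |f x| = |f x| ^ (q - 1) := by
          have e : |f x| ^ (q - 1) = |f x| ^ (q - 2 + 1) := by congr 1; ring
          rw [e, Real.rpow_add hp, Real.rpow_one]
        rw [this]
        exact Real.rpow_le_rpow hp.le (hM x) (by linarith)
  rw [← ofReal_integral_eq_lintegral_ofReal hint0 (Eventually.of_forall fun x => by positivity),
    ← ofReal_integral_eq_lintegral_ofReal (hint c) (Eventually.of_forall fun x => by positivity)]
  apply ENNReal.ofReal_le_ofReal
  calc ∫ x, |f x| ^ q ∂m = ∫ x, (|f x| ^ q - q * c * (|f x| ^ (q - 2) * f x)) ∂m := by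
        rw [integral_sub hint0 (hint2.const_mul _), integral_const_mul, h0]; simp
    _ ≤ _ := integral_mono (hint0.sub (hint2.const_mul _)) (hint c) fun x => tangent hq _ _

lemma final_arith {q : ℝ} (hq : 1 < q) {h D G N : ℝ≥0∞} (hD : D ≠ 0) (hDG : D ≤ G) (hG : G ≠ ⊤)
    (H : h * G ≤ ENNReal.ofReal q * (G ^ ((q - 1) / q) * N ^ (1 / q))) :
    (h / ENNReal.ofReal q) ^ q ≤ N / D := by
  have hq0 : 0 < q := by linarith
  have hG0 : G ≠ 0 := fun h0 => hD (le_antisymm (h0 ▸ hDG) zero_le)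
  have hqq0 : ENNReal.ofReal q ≠ 0 := by simpa using hq0
  have hA0 : G ^ ((q - 1) / q) ≠ 0 := by
    simp [ENNReal.rpow_eq_zero_iff, hG0, hG]
  have hAt : G ^ ((q - 1) / q) ≠ ⊤ := ENNReal.rpow_ne_top_of_nonneg (by
    apply div_nonneg <;> linarith) hG
  have hsplit : G = G ^ ((q - 1) / q) * G ^ (1 / q) := by
    rw [← ENNReal.rpow_add _ _ hG0 hG]
    have : (q - 1) / q + 1 / q = 1 := by field_simp; ring
    rw [this, ENNReal.rpow_one]
  have H1 : h * G ^ (1 / q) ≤ ENNReal.ofReal q * N ^ (1 / q) := by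
    rw [← ENNReal.mul_le_mul_iff_right hA0 hAt]
    calc G ^ ((q - 1) / q) * (h * G ^ (1 / q))
        = h * (G ^ ((q - 1) / q) * G ^ (1 / q)) := by ring
      _ = h * G := by rw [← hsplit]
      _ ≤ _ := H
      _ = _ := by ring
  have H2 : h / ENNReal.ofReal q * G ^ (1 / q) ≤ N ^ (1 / q) := by
    rw [← ENNReal.mul_le_mul_iff_right hqq0 ENNReal.ofReal_ne_top, ← mul_assoc,
      ENNReal.mul_div_cancel hqq0 ENNReal.ofReal_ne_top]
    exact H1
  have H3 := ENNReal.rpow_le_rpow H2 hq0.le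
  rw [ENNReal.mul_rpow_of_nonneg _ _ hq0.le, ← ENNReal.rpow_mul, ← ENNReal.rpow_mul,
    one_div_mul_cancel hq0.ne', ENNReal.rpow_one, ENNReal.rpow_one] at H3
  rw [ENNReal.le_div_iff_mul_le (Or.inl hD) (Or.inl (ne_top_of_le_ne_top hG hDG))]
  exact (mul_le_mul_right hDG _).trans H3

/-- `q`-Cheeger inequality (finite measure case): for a complete separable metric measure
space with `0 < m(X) < ∞` and `m` finite on bounded sets, for every `q ∈ (1,∞)` one has
`λ_{1,q} ≥ (h(X)/q)^q`; in particular (`q = 2`) Cheeger's inequality `λ_{1,2} ≥ h(X)²/4`. -/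
theorem cheeger_ineq_finite {X : Type*} [MetricSpace X] [CompleteSpace X]
    [TopologicalSpace.SeparableSpace X] [MeasurableSpace X] [BorelSpace X]
    (m : Measure X)
    (hbdd : ∀ s : Set X, Bornology.IsBounded s → m s < ⊤)
    (hpos : 0 < m Set.univ) (hfin : m Set.univ < ⊤)
    (q : ℝ) (hq : 1 < q) :
    (cheegerFin m / ENNReal.ofReal q) ^ q ≤ lambdaOneP m q := by
  have : IsFiniteMeasure m := ⟨hfin⟩
  have hq0 : 0 < q := by linarith
  apply le_sInf
  rintro l ⟨f, ⟨⟨K, hf⟩, hsupp⟩, hne, hint, rfl⟩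
  have hfm : Measurable f := hf.continuous.measurable
  obtain ⟨M, hM⟩ : ∃ M, ∀ x, |f x| ≤ M := by
    obtain ⟨M, hM⟩ := (hf.isBounded_image hsupp).exists_norm_le
    refine ⟨max M 0, fun x => ?_⟩
    by_cases hx : f x = 0
    · rw [hx]; simp
    · exact (hM (f x) ⟨x, hx, rfl⟩).trans (le_max_left _ _)
  obtain ⟨c, hc1, hc2⟩ := exists_median m hpos hfm hM
  have hL1 : LipschitzWith K (fun x => f x - c) :=
    LipschitzWith.of_dist_le_mul fun x y => by simpa using hf.dist_le_mul x y
  have hL2 : LipschitzWith K (fun x => c - f x) :=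
    LipschitzWith.of_dist_le_mul fun x y => by
      have := hf.dist_le_mul x y
      rw [Real.dist_eq, abs_sub_comm] at this
      rw [Real.dist_eq]
      simpa using this
  have hB1 : ∀ x, |f x - c| ≤ M + |c| := fun x => (abs_sub _ _).trans (by linarith [hM x])
  have hB2 : ∀ x, |c - f x| ≤ M + |c| := fun x => by rw [abs_sub_comm]; exact hB1 x
  have m1 := main_half m hq hL1 hB1 hc1
  have m2 := main_half m hq hL2 hB2 hc2
  have e1 : ∀ x, eSlope (fun x => f x - c) x = eSlope f x := by
    intro x; simp [eSlope]
  have e2 : ∀ x, eSlope (fun x => c - f x) x = eSlope f x := by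
    intro x; simp [eSlope, abs_sub_comm]
  simp only [e1] at m1
  simp only [e2] at m2
  have hsm := measurable_eSlope hf.continuous
  have hG : ∫⁻ x, ENNReal.ofReal (|f x - c| ^ q) ∂m =
      (∫⁻ x, ENNReal.ofReal (max (f x - c) 0 ^ q) ∂m) +
      ∫⁻ x, ENNReal.ofReal (max (c - f x) 0 ^ q) ∂m := by
    rw [← lintegral_add_left (by fun_prop)]
    apply lintegral_congr
    intro x
    rcases le_total (f x) c with h | h
    · rw [max_eq_right (by linarith : f x - c ≤ 0), max_eq_left (by linarith : 0 ≤ c - f x),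
        abs_sub_comm, abs_of_nonneg (by linarith : 0 ≤ c - f x), Real.zero_rpow hq0.ne']
      simp
    · rw [max_eq_left (by linarith : 0 ≤ f x - c), max_eq_right (by linarith : c - f x ≤ 0),
        abs_of_nonneg (by linarith : 0 ≤ f x - c), Real.zero_rpow hq0.ne']
      simp
  have hR : (∫⁻ x, ENNReal.ofReal (q * max (f x - c) 0 ^ (q - 1)) * eSlope f x ∂m) +
      (∫⁻ x, ENNReal.ofReal (q * max (c - f x) 0 ^ (q - 1)) * eSlope f x ∂m) =
      ENNReal.ofReal q * ∫⁻ x, ENNReal.ofReal (|f x - c| ^ (q - 1)) * eSlope f x ∂m := by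
    rw [← lintegral_add_left (by fun_prop), ← lintegral_const_mul _ (by fun_prop)]
    apply lintegral_congr
    intro x
    have hq1 : q - 1 ≠ 0 := by linarith
    rw [← mul_assoc, ← ENNReal.ofReal_mul hq0.le]
    rcases le_total (f x) c with h | h
    · rw [max_eq_right (by linarith : f x - c ≤ 0), max_eq_left (by linarith : 0 ≤ c - f x),
        abs_sub_comm, abs_of_nonneg (by linarith : 0 ≤ c - f x), Real.zero_rpow hq1]
      simp
    · rw [max_eq_left (by linarith : 0 ≤ f x - c), max_eq_right (by linarith : c - f x ≤ 0),
        abs_of_nonneg (by linarith : 0 ≤ f x - c), Real.zero_rpow hq1]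
      simp
  have hold : ∫⁻ x, ENNReal.ofReal (|f x - c| ^ (q - 1)) * eSlope f x ∂m ≤
      (∫⁻ x, ENNReal.ofReal (|f x - c| ^ q) ∂m) ^ ((q - 1) / q) *
      (∫⁻ x, ENNReal.ofReal (lipSlope f x ^ q) ∂m) ^ (1 / q) := by
    have hconj : (q / (q - 1)).HolderConjugate q :=
      (Real.HolderConjugate.conjExponent hq).symm
    have := ENNReal.lintegral_mul_le_Lp_mul_Lq m hconj
      (f := fun x => ENNReal.ofReal (|f x - c| ^ (q - 1))) (g := eSlope f)
      (by fun_prop) hsm.aemeasurable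
    refine this.trans (le_of_eq ?_)
    congr 2
    · apply lintegral_congr
      intro x
      rw [ENNReal.ofReal_rpow_of_nonneg (by positivity) (by
        apply div_nonneg <;> linarith), ← Real.rpow_mul (abs_nonneg _)]
      congr 2
      have : q - 1 ≠ 0 := by linarith
      field_simp
    · rw [one_div_div]
    · apply lintegral_congr
      intro x
      obtain ⟨a, b⟩ := lipSlope_bounds hf x
      rw [← a, ENNReal.ofReal_rpow_of_nonneg b hq0.le]
  apply final_arith hq (G := ∫⁻ x, ENNReal.ofReal (|f x - c| ^ q) ∂m)
  · rw [Ne, lintegral_eq_zero_iff (by fun_prop)]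
    intro h0
    apply hne
    filter_upwards [h0] with x hx
    simp only [Pi.zero_apply, ENNReal.ofReal_eq_zero] at hx ⊢
    by_contra hfx
    have : 0 < |f x| ^ q := Real.rpow_pos_of_pos (abs_pos.2 hfx) _
    linarith
  · exact lintegral_shift m hq hfm hM hint c
  · refine ne_top_of_le_ne_top ?_ (lintegral_mono (g := fun _ => ENNReal.ofReal ((M + |c|) ^ q)) ?_)
    · rw [lintegral_const]
      exact ENNReal.mul_ne_top ENNReal.ofReal_ne_top hfin.ne
    · intro x
      exact ENNReal.ofReal_le_ofReal (Real.rpow_le_rpow (abs_nonneg _) (hB1 x) hq0.le)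
  · refine le_trans ?_ (mul_le_mul_right hold _)
    rw [← hR, hG, mul_add]
    exact add_le_add m1 m2
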